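/- Let w : ℕ → Σ₃ be an infinite word containing no factor of exponent 5/2 or greater, and suppose w = g(u) for some infinite word u : ℕ → Σ₃, where g = [a,b,c] with a, b, c nonempty finite words satisfying: (1) b is a prefix of a and a is a prefix of c; (2) |b| ≥ |c|/2; (3) b and c have a common suffix s with |s| ≥ |b|/2. Then for each positive integer n there is an infinite word v such that a final segment of w has the form g(γ^{2n}(v)). Consequently L(w) ⊇ L(g(G)). -/

import Mathlib

/-! Common definitions: the alphabet Σ₃, finite and infinite words, factors,
factor complexity, periods and exponents, morphisms, the morphism γ and its
fixed point G = γ^ω(0). -/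

abbrev Sigma3 := Fin 3
abbrev Word := List Sigma3
abbrev InfWord := ℕ → Sigma3

/-- `u` is a factor of the infinite word `w`. -/
def IsFactor (u : Word) (w : InfWord) : Prop :=
  ∃ i : ℕ, u = (List.range u.length).map (fun j => w (i + j))

/-- The set of finite factors of `w`. -/
def Lang (w : InfWord) : Set Word := {u | IsFactor u w}

/-- Factor complexity: the number of distinct length-`n` factors of `w`. -/
noncomputable def complexity (w : InfWord) (n : ℕ) : ℕ :=
  Set.ncard {u : Word | IsFactor u w ∧ u.length = n}

/-- `v` has period `p` (with `p ≥ 1`). -/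
def HasPeriod (v : Word) (p : ℕ) : Prop :=
  1 ≤ p ∧ ∀ i, i + p < v.length → v.getD i 0 = v.getD (i + p) 0

/-- The least period of `v`. -/
noncomputable def minPeriod (v : Word) : ℕ := sInf {p | HasPeriod v p}

/-- The exponent `|v| / p` of a nonempty finite word `v`, where `p` is its least period. -/
noncomputable def expo (v : Word) : ℝ := (v.length : ℝ) / (minPeriod v : ℝ)

/-- `w` contains no factor of exponent `5/2` or greater. -/
def NoFiveHalves (w : InfWord) : Prop :=
  ∀ u : Word, u ≠ [] → IsFactor u w → expo u < 5 / 2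

/-- Apply a morphism (given by the images of the three letters) to a finite word. -/
def applyM (f : Sigma3 → Word) (u : Word) : Word := (u.map f).flatten

/-- The image under `f` of the length-`k` prefix of the infinite word `u`. -/
def imPrefix (f : Sigma3 → Word) (u : InfWord) (k : ℕ) : Word :=
  applyM f ((List.range k).map u)

/-- The image of an infinite word under a (non-erasing) morphism. -/
def applyMInf (f : Sigma3 → Word) (u : InfWord) : InfWord :=
  fun n => (imPrefix f u (n + 1)).getD n 0

/-- The morphism `γ = [01, 2, 02]`. -/
def gam : Sigma3 → Word := ![[0, 1], [2], [0, 2]]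

/-- The fixed point `G = γ^ω(0)` of `γ`, the unique infinite fixed point beginning with 0. -/
def G : InfWord := fun n => ((applyM gam)^[n + 1] [0]).getD n 0

/-- The final segment of `w` starting at position `k`. -/
def shift (w : InfWord) (k : ℕ) : InfWord := fun i => w (i + k)

/-- The reverse `h^R` of a morphism `h`. -/
def mR (f : Sigma3 → Word) : Sigma3 → Word := fun x => (f x).reverse

/-! ### Segments of infinite words -/

/-- The factor of `w` of length `n` starting at position `i`. -/
def seg (w : InfWord) (i n : ℕ) : Word := (List.range n).map (fun j => w (i + j))

@[simp] theorem length_seg (w : InfWord) (i n : ℕ) : (seg w i n).length = n := by simp [seg]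

theorem seg_add (w : InfWord) (i m n : ℕ) :
    seg w i (m + n) = seg w i m ++ seg w (i + m) n := by
  simp [seg, List.range_add, add_assoc, Function.comp_def]

theorem seg_zero (w : InfWord) (i : ℕ) : seg w i 0 = [] := rfl

theorem seg_one (w : InfWord) (i : ℕ) : seg w i 1 = [w i] := by
  simp [seg]

theorem seg_succ (w : InfWord) (i n : ℕ) : seg w i (n + 1) = w i :: seg w (i + 1) n := by
  rw [add_comm, seg_add, seg_one, List.singleton_append]

theorem seg_shift (w : InfWord) (k i n : ℕ) : seg (shift w k) i n = seg w (k + i) n := by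
  simp only [seg, shift]
  refine List.map_congr_left fun j _ => ?_
  congr 1
  omega

theorem map_range_eq_seg (w : InfWord) (k : ℕ) : (List.range k).map w = seg w 0 k := by
  simp [seg]

theorem seg_getD (w : InfWord) {i n j : ℕ} (h : j < n) : (seg w i n).getD j 0 = w (i + j) := by
  simp [seg, h]

theorem isFactor_of_infix_seg {z : Word} {w : InfWord} {k n : ℕ} (h : z <:+: seg w k n) :
    IsFactor z w := by
  obtain ⟨x, y, hxy⟩ := h
  have hn : n = x.length + z.length + y.length := by
    have := congrArg List.length hxy
    simp at this
    omega
  rw [hn, seg_add, seg_add] at hxy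
  have h1 := (List.append_inj hxy (by simp)).1
  exact ⟨k + x.length, (List.append_inj h1 (by simp)).2⟩

/-! ### Morphisms -/

theorem applyM_append (f : Sigma3 → Word) (x y : Word) :
    applyM f (x ++ y) = applyM f x ++ applyM f y := by
  simp [applyM]

theorem applyM_cons (f : Sigma3 → Word) (x : Sigma3) (y : Word) :
    applyM f (x :: y) = f x ++ applyM f y := by
  simp [applyM]

theorem applyM_nil (f : Sigma3 → Word) : applyM f [] = [] := rfl

theorem applyM_singleton (f : Sigma3 → Word) (x : Sigma3) : applyM f [x] = f x := by
  simp [applyM]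

theorem applyM_comp (f g : Sigma3 → Word) (z : Word) :
    applyM (fun x => applyM f (g x)) z = applyM f (applyM g z) := by
  induction z with
  | nil => rfl
  | cons x z ih => rw [applyM_cons, applyM_cons, applyM_append, ih]

theorem applyM_infix (f : Sigma3 → Word) {x y : Word} (h : x <:+: y) :
    applyM f x <:+: applyM f y := by
  obtain ⟨p, q, rfl⟩ := h
  exact ⟨applyM f p, applyM f q, by simp [applyM_append]⟩

theorem applyM_prefix (f : Sigma3 → Word) {x y : Word} (h : x <+: y) :
    applyM f x <+: applyM f y := by
  obtain ⟨q, rfl⟩ := h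
  exact ⟨applyM f q, by simp [applyM_append]⟩

theorem length_le_length_applyM {f : Sigma3 → Word} (hf : ∀ x, f x ≠ []) (z : Word) :
    z.length ≤ (applyM f z).length := by
  induction z with
  | nil => simp
  | cons x z ih =>
    have := List.length_pos_iff.2 (hf x)
    simp only [applyM_cons, List.length_append, List.length_cons]
    omega

theorem applyM_ne_nil {f : Sigma3 → Word} (hf : ∀ x, f x ≠ []) {z : Word} (hz : z ≠ []) :
    applyM f z ≠ [] := by
  have := List.length_pos_iff.2 hz
  exact List.length_pos_iff.1 (this.trans_le (length_le_length_applyM hf z))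

theorem applyM_iterate (f : Sigma3 → Word) (m : ℕ) (z : Word) :
    applyM (fun x => (applyM f)^[m] [x]) z = (applyM f)^[m] z := by
  induction m with
  | zero =>
    induction z with
    | nil => rfl
    | cons x z ih => simpa [applyM_cons] using ih
  | succ m ih =>
    simp only [Function.iterate_succ_apply']
    rw [applyM_comp, ih]

theorem iterate_applyM_infix (f : Sigma3 → Word) (m : ℕ) {x y : Word} (h : x <:+: y) :
    (applyM f)^[m] x <:+: (applyM f)^[m] y := by
  rw [← applyM_iterate, ← applyM_iterate f m y]
  exact applyM_infix _ h

theorem iterate_applyM_ne_nil {f : Sigma3 → Word} (hf : ∀ x, f x ≠ []) (m : ℕ) {z : Word}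
    (hz : z ≠ []) : (applyM f)^[m] z ≠ [] := by
  induction m with
  | zero => exact hz
  | succ m ih =>
    rw [Function.iterate_succ_apply']
    exact applyM_ne_nil hf ih

theorem gam_ne_nil (x : Sigma3) : gam x ≠ [] := by
  fin_cases x <;> simp [gam]

/-! ### Images of infinite words -/

theorem imPrefix_eq (f : Sigma3 → Word) (u : InfWord) (k : ℕ) :
    imPrefix f u k = applyM f (seg u 0 k) := by
  rw [imPrefix, map_range_eq_seg]

theorem imPrefix_add (f : Sigma3 → Word) (u : InfWord) (k m : ℕ) :
    imPrefix f u (k + m) = imPrefix f u k ++ imPrefix f (shift u k) m := by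
  simp only [imPrefix_eq, seg_add, applyM_append, seg_shift, zero_add, add_zero]

theorem le_length_imPrefix {f : Sigma3 → Word} (hf : ∀ x, f x ≠ []) (u : InfWord) (k : ℕ) :
    k ≤ (imPrefix f u k).length := by
  rw [imPrefix_eq]
  simpa using length_le_length_applyM hf (seg u 0 k)

theorem getD_of_prefix {x y : Word} (h : x <+: y) {n : ℕ} (hn : n < x.length) :
    y.getD n 0 = x.getD n 0 := by
  obtain ⟨t, rfl⟩ := h
  exact List.getD_append x t 0 n hn

theorem imPrefix_prefix (f : Sigma3 → Word) (u : InfWord) {k m : ℕ} (h : k ≤ m) :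
    imPrefix f u k <+: imPrefix f u m := by
  obtain ⟨d, rfl⟩ := Nat.exists_eq_add_of_le h
  rw [imPrefix_add]
  exact List.prefix_append _ _

theorem applyMInf_apply {f : Sigma3 → Word} (hf : ∀ x, f x ≠ []) (u : InfWord) {k n : ℕ}
    (hn : n < (imPrefix f u k).length) : applyMInf f u n = (imPrefix f u k).getD n 0 := by
  have hn' : n < (imPrefix f u (n + 1)).length := le_length_imPrefix hf u (n + 1)
  rcases le_total k (n + 1) with h | h
  · exact getD_of_prefix (imPrefix_prefix f u h) hn
  · exact (getD_of_prefix (imPrefix_prefix f u h) hn').symm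

theorem seg_eq_of_getD {w : InfWord} {x : Word} {i : ℕ}
    (h : ∀ n, n < x.length → w (i + n) = x.getD n 0) : seg w i x.length = x := by
  refine List.ext_getElem (by simp) fun n h1 h2 => ?_
  have := h n h2
  simp_all [seg]

theorem seg_applyMInf {f : Sigma3 → Word} (hf : ∀ x, f x ≠ []) (u : InfWord) (k : ℕ) :
    seg (applyMInf f u) 0 (imPrefix f u k).length = imPrefix f u k :=
  seg_eq_of_getD fun n hn => by rw [zero_add, applyMInf_apply hf u hn]

theorem eq_applyMInf {f : Sigma3 → Word} (hf : ∀ x, f x ≠ []) {u w : InfWord}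
    (h : ∀ k, seg w 0 (imPrefix f u k).length = imPrefix f u k) : w = applyMInf f u := by
  funext n
  have hn : n < (imPrefix f u (n + 1)).length := le_length_imPrefix hf u (n + 1)
  rw [applyMInf, ← h (n + 1), seg_getD w (by simpa using hn), zero_add]

theorem shift_applyMInf {f : Sigma3 → Word} (hf : ∀ x, f x ≠ []) (u : InfWord) (k : ℕ) :
    shift (applyMInf f u) (imPrefix f u k).length = applyMInf f (shift u k) := by
  refine eq_applyMInf hf fun m => ?_
  have h := seg_applyMInf hf u (k + m)
  rw [imPrefix_add, List.length_append, seg_add] at h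
  rw [seg_shift, add_zero]
  simpa using (List.append_inj h (by simp)).2

theorem applyMInf_applyMInf {f g : Sigma3 → Word} (hf : ∀ x, f x ≠ []) (hg : ∀ x, g x ≠ [])
    (u : InfWord) :
    applyMInf f (applyMInf g u) = applyMInf (fun x => applyM f (g x)) u := by
  refine eq_applyMInf (fun x => applyM_ne_nil hf (hg x)) fun k => ?_
  have h : imPrefix (fun x => applyM f (g x)) u k
      = imPrefix f (applyMInf g u) (imPrefix g u k).length := by
    rw [imPrefix_eq f, seg_applyMInf hg, imPrefix_eq, applyM_comp, imPrefix_eq]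
  rw [h]
  exact seg_applyMInf hf _ _

theorem shift_shift (w : InfWord) (k m : ℕ) : shift (shift w k) m = shift w (k + m) := by
  funext i
  simp only [shift]
  congr 1
  omega

/-! ### Powers of exponent at least `5/2` -/

/-- `z` contains a factor `p p q` with `q` a prefix of `p` of length at least `|p| / 2`. -/
def HasFiveHalves (z : Word) : Prop :=
  ∃ p q : Word, p ≠ [] ∧ q <+: p ∧ p.length ≤ 2 * q.length ∧ p ++ p ++ q <:+: z

theorem HasFiveHalves.mono {x y : Word} (h : HasFiveHalves x) (hxy : x <:+: y) :
    HasFiveHalves y := by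
  obtain ⟨p, q, h1, h2, h3, h4⟩ := h
  exact ⟨p, q, h1, h2, h3, h4.trans hxy⟩

theorem hasPeriod_append_append {p q : Word} (hp : p ≠ []) (hq : q <+: p) :
    HasPeriod (p ++ p ++ q) p.length := by
  refine ⟨List.length_pos_iff.2 hp, fun i hi => ?_⟩
  obtain ⟨t, rfl⟩ := hq
  have h1 : (q ++ t ++ (q ++ t) ++ q) = (q ++ t) ++ ((q ++ t) ++ q) := by simp
  have h2 : ((q ++ t) ++ ((q ++ t) ++ q)).getD (i + (q ++ t).length) 0
      = ((q ++ t) ++ q).getD i 0 := by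
    rw [List.getD_append_right _ _ _ _ (by omega)]
    congr 1
    omega
  rw [h1] at hi ⊢
  rw [h2]
  refine getD_of_prefix ⟨t ++ q, by simp⟩ ?_
  simp only [List.length_append] at hi ⊢
  omega

theorem five_halves_le_expo {p q : Word} (hp : p ≠ []) (hq : q <+: p)
    (hpq : p.length ≤ 2 * q.length) : 5 / 2 ≤ expo (p ++ p ++ q) := by
  have hper := hasPeriod_append_append hp hq
  have hle : minPeriod (p ++ p ++ q) ≤ p.length := Nat.sInf_le hper
  have hpos : 1 ≤ minPeriod (p ++ p ++ q) :=
    (show minPeriod (p ++ p ++ q) ∈ {k | HasPeriod (p ++ p ++ q) k} from Nat.sInf_mem ⟨_, hper⟩).1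
  have hlen : 5 * minPeriod (p ++ p ++ q) ≤ 2 * (p ++ p ++ q).length := by
    have : (p ++ p ++ q).length = p.length + p.length + q.length := by simp [add_assoc]
    omega
  have hpos' : (0 : ℝ) < minPeriod (p ++ p ++ q) := by exact_mod_cast hpos
  have hlen' : (5 : ℝ) * minPeriod (p ++ p ++ q) ≤ 2 * (p ++ p ++ q).length := by
    exact_mod_cast hlen
  rw [expo, le_div_iff₀ hpos']
  linarith

theorem NoFiveHalves.not_hasFiveHalves_seg {w : InfWord} (hw : NoFiveHalves w) (i n : ℕ) :
    ¬ HasFiveHalves (seg w i n) := by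
  rintro ⟨p, q, hp, hq, hpq, h⟩
  exact absurd (hw _ (by simp [hp]) (isFactor_of_infix_seg h))
    (not_lt.2 (five_halves_le_expo hp hq hpq))

/-! ### Desubstitution -/

/-- The images of the factors of `u` under some morphism `[a, b, c]` with `b` a prefix of `a`,
`a` a prefix of `c`, `|c| ≤ 2 |b|`, and a common suffix of `b` and `c` of length at least
`|b| / 2`, contain no power of exponent `5/2` or greater. -/
def Desubstitutable (u : InfWord) : Prop :=
  ∃ a b c s : Word, b ≠ [] ∧ b <+: a ∧ a <+: c ∧ c.length ≤ 2 * b.length ∧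
    s <:+ b ∧ s <:+ c ∧ b.length ≤ 2 * s.length ∧
    ∀ i n, ¬ HasFiveHalves (applyM ![a, b, c] (seg u i n))

theorem Desubstitutable.ne_succ {u : InfWord} (h : Desubstitutable u) (i : ℕ) :
    u i ≠ u (i + 1) := by
  obtain ⟨a, b, c, s, hb, hba, hac, hcb, -, -, -, hu⟩ := h
  intro he
  have hpre : ∀ x, b <+: ![a, b, c] x := by
    intro x
    fin_cases x
    exacts [hba, List.prefix_rfl, hba.trans hac]
  have hle : ∀ x, (![a, b, c] x).length ≤ 2 * b.length := by
    have := hac.length_le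
    intro x
    fin_cases x <;> simp <;> omega
  refine hu i 3 ⟨![a, b, c] (u i), b, ?_, hpre _, hle _, ?_⟩
  · exact fun h0 => hb (List.prefix_nil.1 (h0 ▸ hpre (u i)))
  · obtain ⟨r, hr⟩ := hpre (u (i + 2))
    refine ⟨[], r, ?_⟩
    rw [seg_succ, seg_succ, seg_one, applyM_cons, applyM_cons, applyM_singleton, ← he,
      show i + 1 + 1 = i + 2 from rfl, ← hr]
    simp

theorem Desubstitutable.succ_ne_one {u : InfWord} (h : Desubstitutable u) {i : ℕ}
    (hi : u i = 2) : u (i + 1) ≠ 1 := by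
  obtain ⟨a, b, c, s, hb, hba, hac, hcb, ⟨t, rfl⟩, ⟨t', rfl⟩, hs, hu⟩ := h
  intro h1
  have hpre : ∀ x, t ++ s <+: ![a, t ++ s, t' ++ s] x := by
    intro x
    fin_cases x
    exacts [hba, List.prefix_rfl, hba.trans hac]
  simp only [List.length_append] at hs
  refine hu i 3 ⟨s ++ t, s, ?_, List.prefix_append _ _, by simp only [List.length_append]; omega, ?_⟩
  · intro h0
    simp at h0
    simp [h0] at hb
  · obtain ⟨r, hr⟩ := hpre (u (i + 2))
    refine ⟨t', r, ?_⟩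
    rw [seg_succ, seg_succ, seg_one, applyM_cons, applyM_cons, applyM_singleton, hi, h1,
      show i + 1 + 1 = i + 2 from rfl, ← hr]
    simp

theorem Desubstitutable.not_zero_one_zero_one {u : InfWord} (h : Desubstitutable u) {i : ℕ}
    (h0 : u i = 0) (h1 : u (i + 1) = 1) (h2 : u (i + 2) = 0) : u (i + 3) ≠ 1 := by
  intro h3
  have h4 := h.ne_succ (i + 3)
  obtain ⟨a, b, c, s, hb, hba, hac, hcb, -, -, -, hu⟩ := h
  have hpre : a <+: ![a, b, c] (u (i + 4)) := by
    rw [h3] at h4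
    change 1 ≠ u (i + 4) at h4
    generalize u (i + 4) = x at h4
    fin_cases x
    exacts [List.prefix_rfl, absurd rfl h4, hac]
  refine hu i 5 ⟨a ++ b, a, by simp [hb], List.prefix_append _ _, ?_, ?_⟩
  · have := hba.length_le
    simp only [List.length_append]
    omega
  · obtain ⟨r, hr⟩ := hpre
    refine ⟨[], r, ?_⟩
    rw [seg_succ, seg_succ, seg_succ, seg_succ, seg_one]
    simp only [applyM_cons, applyM_nil, add_assoc, Nat.reduceAdd, h0, h1, h2, h3, ← hr]
    simp

theorem fin_three_cases (x : Sigma3) : x = 0 ∨ x = 1 ∨ x = 2 := by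
  fin_cases x <;> simp

theorem Desubstitutable.exists_eq_two_of_eq_zero {u : InfWord} (h : Desubstitutable u) {i : ℕ}
    (h0 : u i = 0) :
    u (i + 1) = 2 ∨ (u (i + 1) = 1 ∧ u (i + 2) = 2) ∨
      (u (i + 1) = 1 ∧ u (i + 2) = 0 ∧ u (i + 3) = 2) := by
  have e0 := h.ne_succ i
  have e1 := h.ne_succ (i + 1)
  have e2 := h.ne_succ (i + 2)
  have e3 := h.not_zero_one_zero_one h0
  simp only [add_assoc, Nat.reduceAdd] at e0 e1 e2
  have c1 := fin_three_cases (u (i + 1))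
  have c2 := fin_three_cases (u (i + 2))
  have c3 := fin_three_cases (u (i + 3))
  grind

theorem Desubstitutable.exists_eq_two {u : InfWord} (h : Desubstitutable u) :
    ∃ i, u i = 2 := by
  have of_zero : ∀ i, u i = 0 → ∃ i, u i = 2 := fun i hi => by
    rcases h.exists_eq_two_of_eq_zero hi with h | h | h
    exacts [⟨_, h⟩, ⟨_, h.2⟩, ⟨_, h.2.2⟩]
  rcases fin_three_cases (u 0) with h0 | h0 | h0
  · exact of_zero 0 h0
  · rcases fin_three_cases (u 1) with h1 | h1 | h1
    · exact of_zero 1 h1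
    · exact absurd (h0.trans h1.symm) (h.ne_succ 0)
    · exact ⟨1, h1⟩
  · exact ⟨0, h0⟩

theorem Desubstitutable.exists_block {u : InfWord} (h : Desubstitutable u) {i : ℕ}
    (hi : u i = 2) :
    ∃ x : Sigma3, u (i + ((applyM gam)^[2] [x]).length) = 2 ∧
      seg u (i + 1) ((applyM gam)^[2] [x]).length = (applyM gam)^[2] [x] := by
  have h0 : u (i + 1) = 0 := by
    have e := h.ne_succ i
    rcases fin_three_cases (u (i + 1)) with h1 | h1 | h1
    · exact h1
    · exact absurd h1 (h.succ_ne_one hi)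
    · exact absurd (hi.trans h1.symm) e
  rcases h.exists_eq_two_of_eq_zero h0 with h1 | ⟨h1, h2⟩ | ⟨h1, h2, h3⟩
  · exact ⟨1, by simpa [applyM, gam] using h1, by simp_all [applyM, gam, seg_succ, seg_zero]⟩
  · exact ⟨0, by simpa [applyM, gam] using h2,
      by simp_all [applyM, gam, seg_succ, seg_zero, add_assoc]⟩
  · exact ⟨2, by simpa [applyM, gam] using h3,
      by simp_all [applyM, gam, seg_succ, seg_zero, add_assoc]⟩

theorem append_applyM_comm {f g : Sigma3 → Word} {c : Word} (h : ∀ x, c ++ f x = g x ++ c)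
    (z : Word) : c ++ applyM f z = applyM g z ++ c := by
  induction z with
  | nil => simp [applyM_nil]
  | cons x z ih => rw [applyM_cons, applyM_cons, ← List.append_assoc, h, List.append_assoc, ih,
      List.append_assoc]

theorem Desubstitutable.exists_shift_eq {u : InfWord} (h : Desubstitutable u) :
    ∃ (k : ℕ) (v : InfWord),
      shift u k = applyMInf (fun x => (applyM gam)^[2] [x]) v ∧ Desubstitutable v := by
  obtain ⟨i₀, hi₀⟩ := h.exists_eq_two
  choose! x hx hseg using fun i (hi : u i = 2) => h.exists_block hi
  set γ₂ : Sigma3 → Word := fun x => (applyM gam)^[2] [x] with hγ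
  let q : ℕ → ℕ := fun n => (fun i => i + (γ₂ (x i)).length)^[n] i₀
  have hq_succ (n : ℕ) : q (n + 1) = q n + (γ₂ (x (q n))).length :=
    Function.iterate_succ_apply' _ _ _
  have hq (n : ℕ) : u (q n) = 2 := by
    induction n with
    | zero => exact hi₀
    | succ n ih => rw [hq_succ]; exact hx _ ih
  let v : InfWord := fun n => x (q n)
  have hv (i n : ℕ) : ∃ m, q (i + n) = q i + m ∧ applyM γ₂ (seg v i n) = seg u (q i + 1) m := by
    induction n with
    | zero => exact ⟨0, rfl, rfl⟩
    | succ n ih =>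
      obtain ⟨m, hm, hm'⟩ := ih
      refine ⟨m + (γ₂ (x (q (i + n)))).length, by rw [← add_assoc, hq_succ, ← add_assoc, hm], ?_⟩
      have := hseg _ (hq (i + n))
      rw [seg_add, seg_one, applyM_append, applyM_singleton, hm', seg_add]
      congr 1
      rw [show q i + 1 + m = q (i + n) + 1 by omega]
      exact this.symm
  have hγ₂ (x : Sigma3) : γ₂ x ≠ [] := iterate_applyM_ne_nil gam_ne_nil 2 (by simp)
  refine ⟨i₀ + 1, v, eq_applyMInf hγ₂ fun k => ?_, ?_⟩
  · obtain ⟨m, -, hm⟩ := hv 0 k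
    rw [imPrefix_eq, hm, seg_shift, length_seg]
    rfl
  · obtain ⟨a, b, c, s, hb, hba, hac, hcb, ⟨t, ht⟩, ⟨t', ht'⟩, hs, hu⟩ := h
    have l1 := hba.length_le
    have l2 := hac.length_le
    refine ⟨c ++ a ++ b, c ++ a, c ++ a ++ b ++ a, s ++ a, ?_, List.prefix_append _ _,
      List.prefix_append _ _, ?_, ⟨t', ?_⟩, ⟨c ++ a ++ t, ?_⟩, ?_, fun i n hbig => ?_⟩
    · simp only [ne_eq, List.append_eq_nil_iff, not_and]
      intro hc
      rw [hc] at hac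
      have ha := List.prefix_nil.1 hac
      rw [ha] at hba
      exact absurd (List.prefix_nil.1 hba) hb
    · simp only [List.length_append]
      omega
    · rw [← ht']
      simp
    · rw [← ht]
      simp
    · simp only [List.length_append]
      omega
    · obtain ⟨m, -, hm⟩ := hv i n
      refine hu (q i) (m + 1) (hbig.mono ⟨[], c, ?_⟩)
      have hconj : ∀ y, c ++ applyM ![a, b, c] (γ₂ y)
          = ![c ++ a ++ b, c ++ a, c ++ a ++ b ++ a] y ++ c := by
        intro y
        fin_cases y <;> simp [hγ, applyM, gam]
      rw [seg_succ, applyM_cons, hq, ← hm, ← applyM_comp]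
      exact (append_applyM_comm hconj _).symm

theorem Desubstitutable.exists_shift_eq_iterate (n : ℕ) {u : InfWord} (h : Desubstitutable u) :
    ∃ (k : ℕ) (v : InfWord), shift u k = applyMInf (fun x => (applyM gam)^[2 * n] [x]) v := by
  have hγ (m : ℕ) (x : Sigma3) : (applyM gam)^[m] [x] ≠ [] :=
    iterate_applyM_ne_nil gam_ne_nil m (by simp)
  induction n generalizing u with
  | zero =>
    refine ⟨0, u, eq_applyMInf (hγ _) fun k => ?_⟩
    have : imPrefix (fun x => (applyM gam)^[2 * 0] [x]) u k = seg u 0 k := by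
      rw [imPrefix_eq, applyM_iterate]
      rfl
    rw [this, seg_shift, length_seg]
  | succ n ih =>
    obtain ⟨k, v, hv, hv'⟩ := h.exists_shift_eq
    obtain ⟨k', v', h'⟩ := ih hv'
    refine ⟨k + (imPrefix (fun x => (applyM gam)^[2] [x]) v k').length, v', ?_⟩
    rw [← shift_shift u k, hv, shift_applyMInf (hγ 2) v k', h',
      applyMInf_applyMInf (hγ 2) (hγ _)]
    simp only [applyM_iterate, ← Function.iterate_add_apply]
    rw [show 2 * (n + 1) = 2 + 2 * n by ring]

/-! ### The fixed point of `γ` -/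

theorem iterate_gam_prefix_succ (m : ℕ) :
    (applyM gam)^[m] [0] <+: (applyM gam)^[m + 1] [0] := by
  rw [Function.iterate_succ_apply, ← applyM_iterate gam m, ← applyM_iterate gam m (applyM gam [0])]
  exact applyM_prefix _ ⟨[1], rfl⟩

theorem iterate_gam_prefix {m n : ℕ} (h : m ≤ n) :
    (applyM gam)^[m] [0] <+: (applyM gam)^[n] [0] := by
  induction n, h using Nat.le_induction with
  | base => exact List.prefix_rfl
  | succ n _ ih => exact ih.trans (iterate_gam_prefix_succ n)

theorem lt_length_iterate_gam (m : ℕ) : m < ((applyM gam)^[m] [0]).length := by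
  induction m with
  | zero => simp
  | succ m ih =>
    have h : (applyM gam)^[m + 1] [0] = (applyM gam)^[m] [0] ++ (applyM gam)^[m] [1] := by
      rw [Function.iterate_succ_apply, ← applyM_iterate gam m,
        show applyM gam [0] = [0] ++ [1] from rfl, applyM_append, applyM_iterate, applyM_iterate]
    have h1 := List.length_pos_iff.2
      (iterate_applyM_ne_nil gam_ne_nil m (List.cons_ne_nil (1 : Sigma3) []))
    rw [h, List.length_append]
    omega

theorem seg_G_prefix {k m : ℕ} (h : k ≤ m) : seg G 0 k <+: (applyM gam)^[m] [0] := by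
  have hm := lt_length_iterate_gam m
  have hG : seg G 0 ((applyM gam)^[m] [0]).length = (applyM gam)^[m] [0] :=
    seg_eq_of_getD fun n hn => by
      rw [zero_add, G]
      have hn' := lt_length_iterate_gam (n + 1)
      rcases le_total m (n + 1) with h | h
      · exact getD_of_prefix (iterate_gam_prefix h) hn
      · exact (getD_of_prefix (iterate_gam_prefix h) (by omega)).symm
  rw [← hG, show ((applyM gam)^[m] [0]).length = k + (((applyM gam)^[m] [0]).length - k) by omega,
    seg_add]
  exact List.prefix_append _ _

theorem zero_infix_iterate_gam_two (x : Sigma3) : [0] <:+: (applyM gam)^[2] [x] := by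
  fin_cases x
  exacts [⟨[], [1, 2], rfl⟩, ⟨[], [2], rfl⟩, ⟨[], [1, 0, 2], rfl⟩]

/-- Corollary: under the hypotheses of the iteration lemma, for every `n ≥ 1` a final
segment of `w` has the form `g(γ^{2n}(v))`; consequently `L(w) ⊇ L(g(G))`. -/
theorem stmt4 (w : InfWord) (hp : NoFiveHalves w)
    (a b c : Word) (ha : a ≠ []) (hb : b ≠ []) (hc : c ≠ [])
    (u : InfWord) (hw : w = applyMInf ![a, b, c] u)
    (hba : b <+: a) (hac : a <+: c)
    (hlen : c.length ≤ 2 * b.length)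
    (s : Word) (hsb : s <:+ b) (hsc : s <:+ c) (hs : b.length ≤ 2 * s.length) :
    (∀ n : ℕ, 0 < n → ∃ (k : ℕ) (v : InfWord),
        shift w k = applyMInf (fun x => applyM ![a, b, c] ((applyM gam)^[2 * n] [x])) v) ∧
    Lang (applyMInf ![a, b, c] G) ⊆ Lang w := by
  have hg : ∀ x, ![a, b, c] x ≠ [] := by
    intro x
    fin_cases x
    exacts [ha, hb, hc]
  have hγ (m : ℕ) (x : Sigma3) : (applyM gam)^[m] [x] ≠ [] :=
    iterate_applyM_ne_nil gam_ne_nil m (by simp)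
  have hu : Desubstitutable u := by
    refine ⟨a, b, c, s, hb, hba, hac, hlen, hsb, hsc, hs, fun i n hbig => ?_⟩
    have h1 := seg_applyMInf hg u (i + n)
    rw [← hw] at h1
    refine hp.not_hasFiveHalves_seg 0 (imPrefix ![a, b, c] u (i + n)).length (hbig.mono ?_)
    rw [h1, imPrefix_eq, seg_add, zero_add]
    exact applyM_infix _ (List.suffix_append _ _).isInfix
  have main (n : ℕ) : ∃ (k : ℕ) (v : InfWord),
      shift w k = applyMInf (fun x => applyM ![a, b, c] ((applyM gam)^[2 * n] [x])) v := by
    obtain ⟨k, v, hv⟩ := hu.exists_shift_eq_iterate n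
    refine ⟨(imPrefix ![a, b, c] u k).length, v, ?_⟩
    rw [hw, shift_applyMInf hg, hv, applyMInf_applyMInf hg (hγ _)]
  refine ⟨fun n _ => main n, ?_⟩
  rintro z ⟨i, hz⟩
  set K := i + z.length with hK
  obtain ⟨k, v, hv⟩ := main (K + 1)
  have h1 := seg_applyMInf (fun x => applyM_ne_nil hg (hγ (2 * (K + 1)) x)) v 1
  rw [← hv, seg_shift, imPrefix_eq, seg_one, applyM_singleton] at h1
  suffices h : z <:+: applyM ![a, b, c] ((applyM gam)^[2 * (K + 1)] [v 0]) by
    rw [← h1] at h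
    exact isFactor_of_infix_seg h
  have hzG : z <:+: imPrefix ![a, b, c] G K := by
    rw [← seg_applyMInf hg, Nat.exists_eq_add_of_le (le_length_imPrefix hg G K) |>.choose_spec,
      seg_add, hK, seg_add, zero_add]
    exact ⟨_, _, by rw [← show z = seg _ i z.length from hz]⟩
  refine hzG.trans ?_
  rw [imPrefix_eq]
  refine applyM_infix _ ((seg_G_prefix (by omega : K ≤ 2 * K)).isInfix.trans ?_)
  rw [show 2 * (K + 1) = 2 * K + 2 by ring, Function.iterate_add_apply]
  exact iterate_applyM_infix gam _ (zero_infix_iterate_gam_two _)
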